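/- If $x = (x^1,\dots,x^n)$ and $y = (y^1,\dots,y^n)$ are two sets of good basic invariants of a finite complex reflection group $G$ with respect to the same admissible triplet, then each $y^\alpha$ is a linear combination of those $x^\beta$ with $d_\beta = d_\alpha$; in particular $x$ and $y$ span the same vector subspace of $S[V]^G$. -/

import Mathlib

open MvPolynomial Matrix

noncomputable section

variable {n : ℕ}

/-- Pullback of polynomials along the linear map with matrix `M`:
`(pback M F)(v) = F (M *ᵥ v)`.  The pullback `g^*F` of the paper is `pback (g⁻¹).val F`. -/
def pback (M : Matrix (Fin n) (Fin n) ℂ) :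
    MvPolynomial (Fin n) ℂ →ₐ[ℂ] MvPolynomial (Fin n) ℂ :=
  aeval fun i => ∑ j, C (M i j) * X j

/-- Multi-index partial derivative `∂^a/∂z^a` of a polynomial (in the standard coordinates). -/
def mderiv (a : Fin n → ℕ) (F : MvPolynomial (Fin n) ℂ) : MvPolynomial (Fin n) ℂ :=
  (List.finRange n).foldr (fun i acc => (fun p => pderiv i p)^[a i] acc) F

/-- The linear coordinate `z^α = ∑_j P_{α j} u^j` of the coordinate system given by `P`. -/
def coordPoly (P : GL (Fin n) ℂ) (α : Fin n) : MvPolynomial (Fin n) ℂ :=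
  ∑ j, C (P.val α j) * X j

/-- `∂^a F/∂z^a` evaluated at `q`, where `z = P u` are the coordinates given by `P`. -/
def zderivAt (P : GL (Fin n) ℂ) (a : Fin n → ℕ) (F : MvPolynomial (Fin n) ℂ)
    (q : Fin n → ℂ) : ℂ :=
  eval (P.val *ᵥ q) (mderiv a (pback (P⁻¹).val F))

/-- `g` is a (complex) reflection: it fixes a hyperplane pointwise and is not the identity. -/
def IsReflection (g : GL (Fin n) ℂ) : Prop :=
  g ≠ 1 ∧
    Module.finrank ℂ (LinearMap.range (Matrix.toLin' (g.val - 1))) = 1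

/-- A finite complex reflection group: a finite subgroup generated by its reflections. -/
def IsReflectionGroup (G : Subgroup (GL (Fin n) ℂ)) : Prop :=
  Finite G ∧ Subgroup.closure {g | g ∈ G ∧ IsReflection g} = G

/-- A regular vector: it lies on no reflection hyperplane of `G`. -/
def IsRegularVec (G : Subgroup (GL (Fin n) ℂ)) (q : Fin n → ℂ) : Prop :=
  q ≠ 0 ∧ ∀ g ∈ G, IsReflection g → g.val *ᵥ q ≠ q

/-- A `ζ`-regular element of `G`: its `ζ`-eigenspace contains a regular vector. -/
def IsZetaRegular (G : Subgroup (GL (Fin n) ℂ)) (g : GL (Fin n) ℂ) (ζ : ℂ) : Prop :=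
  g ∈ G ∧ ∃ q, IsRegularVec G q ∧ g.val *ᵥ q = ζ • q

/-- A set of basic invariants of `G` with degrees `d`. -/
structure BasicInvariants (G : Subgroup (GL (Fin n) ℂ)) (d : Fin n → ℕ)
    (x : Fin n → MvPolynomial (Fin n) ℂ) : Prop where
  pos : ∀ α, 0 < d α
  homog : ∀ α, (x α).IsHomogeneous (d α)
  invariant : ∀ g ∈ G, ∀ α, pback (g : GL (Fin n) ℂ).val (x α) = x α
  indep : AlgebraicIndependent ℂ x
  gen : ∀ F : MvPolynomial (Fin n) ℂ, (∀ g ∈ G, pback (g : GL (Fin n) ℂ).val F = F) →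
    F ∈ Algebra.adjoin ℂ (Set.range x)

/-- An admissible triplet `(g, ζ, q)`; the degrees are arranged so that `d 0` is the highest. -/
structure AdmissibleTriplet [NeZero n] (G : Subgroup (GL (Fin n) ℂ)) (d : Fin n → ℕ)
    (g : GL (Fin n) ℂ) (ζ : ℂ) (q : Fin n → ℂ) : Prop where
  prim : IsPrimitiveRoot ζ (d 0)
  reg : IsZetaRegular G g ζ
  regq : IsRegularVec G q
  eig : g.val *ᵥ q = ζ • q

/-- `P` gives a `(g,ζ)`-graded coordinate system: `g^* z^α = ζ^{d_α-1} z^α`. -/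
def GradedCoords (g : GL (Fin n) ℂ) (ζ : ℂ) (d : Fin n → ℕ) (P : GL (Fin n) ℂ) : Prop :=
  ∀ α, pback (g⁻¹).val (coordPoly P α) = C (ζ ^ ((d α : ℤ) - 1)) * coordPoly P α

/-- The multi-index `e_β`. -/
def unitIdx (β : Fin n) : Fin n → ℕ := fun j => if j = β then 1 else 0

/-- `x` is compatible with the coordinate system given by `P` at `q`:
`∂x^α/∂z^β (q) = δ^α_β`. -/
def Compatible (P : GL (Fin n) ℂ) (q : Fin n → ℂ)
    (x : Fin n → MvPolynomial (Fin n) ℂ) : Prop :=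
  ∀ α β, zderivAt P (unitIdx β) (x α) q = if α = β then 1 else 0

/-- `x` is good: the derivatives `∂^a x^α/∂z^a` vanish at `q` for every `a ∈ I_α^{(0)}`. -/
def IsGood [NeZero n] (P : GL (Fin n) ℂ) (q : Fin n → ℂ) (d : Fin n → ℕ)
    (x : Fin n → MvPolynomial (Fin n) ℂ) : Prop :=
  ∀ α (a : Fin n → ℕ), (∑ β, a β * d β) = d α → 2 ≤ ∑ β, a β →
    zderivAt P a (x α) q = 0

/-- Multi-index partial derivative of a function on `ℂ^n`. -/
def mpd (a : Fin n → ℕ) (f : (Fin n → ℂ) → ℂ) : (Fin n → ℂ) → ℂ :=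
  (List.finRange n).foldr
    (fun i acc => (fun g v => fderiv ℂ g v (Pi.single i 1))^[a i] acc) f

/-- `f` is a rational function which is regular at `q`. -/
def RegRat (q : Fin n → ℂ) (f : (Fin n → ℂ) → ℂ) : Prop :=
  ∃ p s : MvPolynomial (Fin n) ℂ, eval q s ≠ 0 ∧
    ∀ v, eval v s ≠ 0 → f v = eval v p / eval v s

/-- Condition `P(i)`: the value at `q` is diagonal and nonvanishing derivatives at `q`
satisfy `a·d + d_β = d_γ + k d_1` with `k ≥ i`. -/
def CondP [NeZero n] (d : Fin n → ℕ) (q : Fin n → ℂ) (i : ℕ)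
    (M : Fin n → Fin n → (Fin n → ℂ) → ℂ) : Prop :=
  (∀ γ β, γ ≠ β → M γ β q = 0) ∧
    ∀ γ β (a : Fin n → ℕ), a ≠ 0 → mpd a (M γ β) q ≠ 0 →
      ∃ k : ℕ, i ≤ k ∧ (∑ α, a α * d α) + d β = d γ + k * d 0

/-- Condition `Q(j,h)`: nonvanishing derivatives at `q` satisfy
`a·d + h + d_β = d_γ + k d_1` with `k ≥ j`. -/
def CondQ [NeZero n] (d : Fin n → ℕ) (q : Fin n → ℂ) (j h : ℕ)
    (M : Fin n → Fin n → (Fin n → ℂ) → ℂ) : Prop :=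
  ∀ γ β (a : Fin n → ℕ), mpd a (M γ β) q ≠ 0 →
    ∃ k : ℕ, j ≤ k ∧ (∑ α, a α * d α) + h + d β = d γ + k * d 0

/-- Entrywise product of matrices of functions. -/
def matMulF (Xm Ym : Fin n → Fin n → (Fin n → ℂ) → ℂ) :
    Fin n → Fin n → (Fin n → ℂ) → ℂ :=
  fun γ β v => ∑ ρ, Xm γ ρ v * Ym ρ β v

/-- The `(γ,β)` entry of the Jacobian matrix `J = (∂x^γ/∂z^β)`, expressed in the
coordinates `z = P u`, as a function on coordinate space. -/
def jacEntry (P : GL (Fin n) ℂ) (x : Fin n → MvPolynomial (Fin n) ℂ) (γ β : Fin n) :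
    (Fin n → ℂ) → ℂ :=
  fun v => eval v (pderiv β (pback (P⁻¹).val (x γ)))

/-! ### Jacobian -/

/-- Directional derivative. -/
def dirD (w : Fin n → ℂ) : Derivation ℂ (MvPolynomial (Fin n) ℂ) (MvPolynomial (Fin n) ℂ) :=
  mkDerivation ℂ (fun j => C (w j))

theorem dirD_X (w : Fin n → ℂ) (i : Fin n) : dirD w (X i) = C (w i) := by
  simp [dirD, mkDerivation_X]

theorem dirD_eq_sum (w : Fin n → ℂ) (F : MvPolynomial (Fin n) ℂ) :
    dirD w F = ∑ j, C (w j) * pderiv j F := by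
  induction F using MvPolynomial.induction_on with
  | C a => simp [dirD]
  | add p q hp hq => simp [hp, hq, mul_add, Finset.sum_add_distrib]
  | mul_X p i hp =>
    simp only [Derivation.leibniz, hp, dirD_X, smul_eq_mul, pderiv_X, mul_add,
      Finset.sum_add_distrib]
    congr 1
    · rw [Finset.sum_eq_single i]
      · simp; ring
      · intro b _ hb
        simp [Ne.symm hb]
      · simp
    · rw [Finset.mul_sum]
      exact Finset.sum_congr rfl fun _ _ => by ring

theorem eval_pback (M : Matrix (Fin n) (Fin n) ℂ) (v : Fin n → ℂ) (F : MvPolynomial (Fin n) ℂ) :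
    eval v (pback M F) = eval (M *ᵥ v) F := by
  induction F using MvPolynomial.induction_on with
  | C a => simp [pback]
  | add p q hp hq => simp [hp, hq]
  | mul_X p i hp =>
    rw [map_mul, map_mul, hp, map_mul]
    congr 1
    simp [pback, Matrix.mulVec, dotProduct]

theorem pback_mul (M N : Matrix (Fin n) (Fin n) ℂ) (F : MvPolynomial (Fin n) ℂ) :
    pback N (pback M F) = pback (M * N) F := by
  apply MvPolynomial.funext
  intro v
  simp [eval_pback]

theorem pback_one (F : MvPolynomial (Fin n) ℂ) :
    pback 1 F = F := by
  apply MvPolynomial.funext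
  intro v
  simp [eval_pback]

theorem eval_dirD_pback (M : Matrix (Fin n) (Fin n) ℂ) (v w : Fin n → ℂ)
    (F : MvPolynomial (Fin n) ℂ) :
    eval v (dirD w (pback M F)) = eval (M *ᵥ v) (dirD (M *ᵥ w) F) := by
  induction F using MvPolynomial.induction_on with
  | C a => simp [pback, dirD]
  | add p q hp hq => simp [hp, hq]
  | mul_X p i hp =>
    simp only [map_mul, Derivation.leibniz, smul_eq_mul, map_add, hp, eval_pback]
    simp [pback, Matrix.mulVec, dotProduct, dirD, mkDerivation_X]

theorem jac_of_trivial_stab (G : Subgroup (GL (Fin n) ℂ)) [Finite G]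
    (d : Fin n → ℕ) (x : Fin n → MvPolynomial (Fin n) ℂ) (hx : BasicInvariants G d x)
    (v : Fin n → ℂ) (hv : ∀ g ∈ G, g ≠ 1 → g.val *ᵥ v ≠ v)
    (w : Fin n → ℂ) (hw : ∀ i, eval v (dirD w (x i)) = 0) : w = 0 := by
  classical
  by_contra hw0
  obtain ⟨i, hi⟩ : ∃ i, w i ≠ 0 := by
    by_contra h
    push Not at h
    exact hw0 (funext h)
  have key : ∀ F ∈ Algebra.adjoin ℂ (Set.range x), eval v (dirD w F) = 0 := by
    intro F hF
    induction hF using Algebra.adjoin_induction with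
    | mem F h => obtain ⟨j, rfl⟩ := h; exact hw j
    | algebraMap r => simp
    | add p q _ _ hp hq => simp [hp, hq]
    | mul p q _ _ hp hq => simp [hp, hq]
  have hk : ∀ g : G, ∃ k, g ≠ 1 → (g.1.val *ᵥ v) k ≠ v k := by
    intro g
    by_cases hg : g = 1
    · exact ⟨i, fun h => absurd hg h⟩
    · have := hv g g.2 (by simpa using hg)
      obtain ⟨k, hk⟩ := Function.ne_iff.1 this
      exact ⟨k, fun _ => hk⟩
  choose k hk using hk
  have := Fintype.ofFinite G
  let r : G → MvPolynomial (Fin n) ℂ := fun g => X (k g) - C ((g.1.val *ᵥ v) (k g))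
  let h : MvPolynomial (Fin n) ℂ := (X i - C (v i)) * ∏ g ∈ Finset.univ.erase (1 : G), (r g) ^ 2
  let F : MvPolynomial (Fin n) ℂ := ∑ g : G, pback g.1.val h
  have hF : ∀ g ∈ G, pback (g : GL (Fin n) ℂ).val F = F := by
    intro g hg
    simp only [F, map_sum, pback_mul]
    exact Fintype.sum_equiv (Equiv.mulRight (⟨g, hg⟩ : G)) _ _ (fun a => by simp)
  have h0 := key F (hx.gen F hF)
  simp only [F, map_sum, eval_dirD_pback] at h0
  rw [Finset.sum_eq_single (1 : G)] at h0
  · simp only [OneMemClass.coe_one, Units.val_one, Matrix.one_mulVec, h, Derivation.leibniz,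
      smul_eq_mul, map_add, map_mul, map_sub, dirD_X, eval_X, eval_C, sub_self, zero_mul,
      zero_add] at h0
    have h2 : dirD w (C (v i)) = 0 := by simp [dirD]
    rw [h2] at h0
    simp only [map_zero, sub_zero, map_prod, map_pow] at h0
    rcases mul_eq_zero.1 h0 with h0 | h0
    · rw [Finset.prod_eq_zero_iff] at h0
      obtain ⟨g, hg, h0⟩ := h0
      have hg1 := (Finset.mem_erase.1 hg).1
      have := hk g hg1
      simp only [r, map_sub, eval_X, eval_C] at h0
      exact this (sub_eq_zero.1 (pow_eq_zero_iff (two_ne_zero) |>.1 h0)).symm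
    · exact hi h0
  · intro g _ hg
    have hm : g ∈ Finset.univ.erase (1 : G) := by simp [hg]
    have he : h = r g * (r g * ((X i - C (v i)) *
        ∏ g ∈ (Finset.univ.erase (1 : G)).erase g, (r g) ^ 2)) := by
      simp only [h]
      rw [← Finset.mul_prod_erase _ _ hm]
      ring
    have hr : eval (g.1.val *ᵥ v) (r g) = 0 := by simp [r]
    rw [he]
    simp only [Derivation.leibniz, smul_eq_mul, map_add, map_mul, hr]
    ring
  · simp

/-- The fixed space of `g`. -/
def fixSp (g : GL (Fin n) ℂ) : Submodule ℂ (Fin n → ℂ) :=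
  LinearMap.ker (Matrix.toLin' (g.val - 1))

theorem mem_fixSp (g : GL (Fin n) ℂ) (v : Fin n → ℂ) : v ∈ fixSp g ↔ g.val *ᵥ v = v := by
  simp [fixSp, sub_eq_zero]

theorem exists_lin (g : GL (Fin n) ℂ) (hg : g ≠ 1) :
    ∃ i, ∃ j, (g.val - 1) i j ≠ 0 := by
  by_contra h
  push Not at h
  apply hg
  ext i j
  have := h i j
  simpa [sub_eq_zero] using this

theorem jac_of_regular (G : Subgroup (GL (Fin n) ℂ)) [Finite G]
    (d : Fin n → ℕ) (x : Fin n → MvPolynomial (Fin n) ℂ) (hx : BasicInvariants G d x)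
    (q : Fin n → ℂ) (hq : IsRegularVec G q) :
    (Matrix.of fun i j => eval q (pderiv j (x i))).det ≠ 0 := by
  classical
  have := Fintype.ofFinite G
  set J : MvPolynomial (Fin n) ℂ := (Matrix.of fun i j => pderiv j (x i)).det with hJ
  have evJ : ∀ v, eval v J = (Matrix.of fun i j => eval v (pderiv j (x i))).det := by
    intro v
    rw [hJ, RingHom.map_det]
    congr 1
  rw [← evJ]
  intro hJq
  -- zeros of J
  have hz : ∀ v, eval v J = 0 → ∃ g : G, g ≠ 1 ∧ v ∈ fixSp g.1 := by
    intro v hv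
    by_contra hcon
    push Not at hcon
    rw [evJ] at hv
    obtain ⟨w, hw0, hw⟩ := Matrix.exists_mulVec_eq_zero_iff.2 hv
    apply hw0
    refine jac_of_trivial_stab G d x hx v ?_ w ?_
    · intro g hg hg1 h
      exact hcon ⟨g, hg⟩ (by simpa using hg1) ((mem_fixSp _ _).2 h)
    · intro i
      have := congrFun hw i
      simp only [Matrix.mulVec, dotProduct, Matrix.of_apply, Pi.zero_apply] at this
      rw [dirD_eq_sum, map_sum, ← this]
      exact Finset.sum_congr rfl fun _ _ => by simp [mul_comm]
  -- a subspace inside the zero set lies in one fixed space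
  have hsub : ∀ W : Submodule ℂ (Fin n → ℂ), (∀ v ∈ W, eval v J = 0) →
      ∃ g : G, g ≠ 1 ∧ W ≤ fixSp g.1 := by
    intro W hW
    have hcov : ⋃ g : {g : G // g ≠ 1}, (((fixSp g.1.1).comap W.subtype : Submodule ℂ W) : Set W)
        = Set.univ := by
      ext ⟨v, hv⟩
      obtain ⟨g, hg, hgv⟩ := hz v (hW v hv)
      simp only [Set.mem_iUnion, Set.mem_univ, iff_true]
      exact ⟨⟨g, hg⟩, hgv⟩
    obtain ⟨g, hg⟩ := Subspace.exists_eq_top_of_iUnion_eq_univ hcov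
    refine ⟨g.1, g.2, fun v hv => ?_⟩
    have : (⟨v, hv⟩ : W) ∈ (fixSp g.1.1).comap W.subtype := by rw [hg]; trivial
    exact this
  have hlin : ∀ g : G, ∃ i, g ≠ 1 → ∃ j, (g.1.val - 1) i j ≠ 0 := by
    intro g
    by_cases hg : g = 1
    · by_cases hn : Nonempty (Fin n)
      · exact ⟨hn.some, fun h => absurd hg h⟩
      · exfalso
        apply hq.1
        ext i
        exact absurd ⟨i⟩ hn
    · obtain ⟨i, hi⟩ := exists_lin g.1 (by simpa using hg)
      exact ⟨i, fun _ => hi⟩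
  choose r hr using hlin
  let l : G → MvPolynomial (Fin n) ℂ := fun g => ∑ j, C ((g.1.val - 1) (r g) j) * X j
  have hl : ∀ g v, eval v (l g) = ((g.1.val - 1) *ᵥ v) (r g) := by
    intro g v
    simp [l, Matrix.mulVec, dotProduct]
  have hl0 : ∀ g, g ≠ 1 → l g ≠ 0 := by
    intro g hg h
    obtain ⟨j, hj⟩ := hr g hg
    apply hj
    have := hl g (Pi.single j 1)
    rw [h] at this
    simpa using this.symm
  have hlh : ∀ g, (l g).IsHomogeneous 1 := fun g =>
    IsHomogeneous.sum _ _ _ fun j _ => isHomogeneous_C_mul_X _ _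
  have hJ0 : J ≠ 0 := by
    intro h0
    obtain ⟨g, hg, hle⟩ := hsub ⊤ (by simp [h0])
    obtain ⟨j, hj⟩ := hr g hg
    have h1 : (Pi.single j 1 : Fin n → ℂ) ∈ fixSp g.1 := hle trivial
    have := congrFun (LinearMap.mem_ker.1 h1) (r g)
    apply hj
    change ((g.1.val - 1) *ᵥ Pi.single j 1) (r g) = 0 at this
    rw [Matrix.mulVec_single_one] at this
    exact this
  have hrad : (∏ g ∈ Finset.univ.erase (1 : G), l g) ∈ (Ideal.span {J}).radical := by
    rw [← vanishingIdeal_zeroLocus_eq_radical (K := ℂ)]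
    rw [mem_vanishingIdeal_iff]
    intro v hv
    have hv0 : eval v J = 0 := by
      have := hv J (Ideal.subset_span rfl)
      simpa [aeval_eq_eval] using this
    obtain ⟨g, hg, hgv⟩ := hz v hv0
    rw [map_prod]
    refine Finset.prod_eq_zero (i := g) (by simp [hg]) ?_
    have : eval v (l g) = 0 := by
      rw [hl]
      exact congrFun (LinearMap.mem_ker.1 hgv) (r g)
    simpa [aeval_eq_eval] using this
  obtain ⟨m, hm⟩ := hrad
  rw [Ideal.mem_span_singleton] at hm
  -- a prime factor vanishing at q
  obtain ⟨f, hf, hfJ, hfq⟩ : ∃ f, Prime f ∧ f ∣ J ∧ eval q f = 0 := by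
    obtain ⟨s, hs, hsJ⟩ := UniqueFactorizationMonoid.exists_prime_factors J hJ0
    obtain ⟨u, hu⟩ := hsJ
    have h1 : eval q s.prod = 0 := by
      have : eval q (s.prod * u) = 0 := by rw [hu, hJq]
      rw [map_mul] at this
      exact (mul_eq_zero.1 this).resolve_right (u.isUnit.map (eval q)).ne_zero
    rw [map_multiset_prod, Multiset.prod_eq_zero_iff, Multiset.mem_map] at h1
    obtain ⟨f, hfs, hf0⟩ := h1
    exact ⟨f, hs f hfs, (Multiset.dvd_prod hfs).trans ⟨u, hu.symm⟩, hf0⟩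
  have hfl := hf.dvd_of_dvd_pow (hfJ.trans hm)
  obtain ⟨g, hg, hfg⟩ := (hf.dvd_finsetProd_iff _).1 hfl
  have hg1 : g ≠ 1 := (Finset.mem_erase.1 hg).1
  obtain ⟨c, hc⟩ := hfg
  have hc0 : c ≠ 0 := by rintro rfl; exact hl0 g hg1 (by simpa using hc)
  have hdeg := congrArg totalDegree hc
  rw [(hlh g).totalDegree (hl0 g hg1), totalDegree_mul_of_isDomain hf.ne_zero hc0] at hdeg
  have hfd : f.totalDegree ≠ 0 := by
    intro h
    rw [totalDegree_eq_zero_iff_eq_C] at h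
    apply hf.not_isUnit
    rw [h]
    refine IsUnit.map C (isUnit_iff_ne_zero.2 ?_)
    intro hprm
    rw [hprm, C_0] at h
    exact hf.ne_zero h
  have hcd : c.totalDegree = 0 := by omega
  rw [totalDegree_eq_zero_iff_eq_C] at hcd
  have hcc : coeff 0 c ≠ 0 := by
    intro hprm
    rw [hprm, C_0] at hcd
    exact hc0 hcd
  let φ : (Fin n → ℂ) →ₗ[ℂ] ℂ := (LinearMap.proj (r g)).comp (Matrix.toLin' (g.1.val - 1))
  have hφ : ∀ v, φ v = eval v (l g) := by
    intro v; rw [hl]; rfl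
  have hφJ : ∀ v ∈ LinearMap.ker φ, eval v J = 0 := by
    intro v hv
    rw [LinearMap.mem_ker, hφ, hc, hcd, map_mul, eval_C] at hv
    have := (mul_eq_zero.1 hv).resolve_right hcc
    obtain ⟨e, he⟩ := hfJ
    rw [he, map_mul, this, zero_mul]
  obtain ⟨h, hh1, hle⟩ := hsub _ hφJ
  have hqk : q ∈ LinearMap.ker φ := by
    rw [LinearMap.mem_ker, hφ, hc, map_mul, hfq, zero_mul]
  have hh1' : h.1 ≠ 1 := by simpa using hh1
  refine hq.2 h.1 h.2 ⟨hh1', ?_⟩ ((mem_fixSp _ _).1 (hle hqk))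
  have e1 := LinearMap.finrank_range_add_finrank_ker (Matrix.toLin' (h.1.val - 1))
  have e2 := LinearMap.finrank_range_add_finrank_ker φ
  have e3 : Module.finrank ℂ (LinearMap.ker φ) ≤
      Module.finrank ℂ (LinearMap.ker (Matrix.toLin' (h.1.val - 1))) :=
    Submodule.finrank_mono hle
  have e4 : Module.finrank ℂ (LinearMap.range φ) ≤ 1 := by
    simpa using Submodule.finrank_le (LinearMap.range φ)
  have e5 : Module.finrank ℂ (LinearMap.range (Matrix.toLin' (h.1.val - 1))) ≠ 0 := by
    intro h0
    rw [Submodule.finrank_eq_zero, LinearMap.range_eq_bot] at h0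
    have : h.1.val - 1 = 0 := by
      apply Matrix.toLin'.injective
      rw [h0, map_zero]
    exact hh1' (Units.ext (sub_eq_zero.1 this))
  omega

/-! ### Translation and coefficients -/

/-- Translation of polynomials. -/
def trl (w : Fin n → ℂ) : MvPolynomial (Fin n) ℂ →ₐ[ℂ] MvPolynomial (Fin n) ℂ :=
  aeval fun i => X i + C (w i)

theorem eval_trl (w v : Fin n → ℂ) (F : MvPolynomial (Fin n) ℂ) :
    eval v (trl w F) = eval (v + w) F := by
  induction F using MvPolynomial.induction_on with
  | C a => simp [trl]
  | add p q hp hq => simp [hp, hq]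
  | mul_X p i hp =>
    rw [map_mul, map_mul, hp, map_mul]
    congr 1
    simp [trl]

theorem pderiv_trl (w : Fin n → ℂ) (i : Fin n) (F : MvPolynomial (Fin n) ℂ) :
    pderiv i (trl w F) = trl w (pderiv i F) := by
  induction F using MvPolynomial.induction_on with
  | C a => simp [trl]
  | add p q hp hq => simp [hp, hq]
  | mul_X p j hp =>
    have h1 : trl w (X j) = X j + C (w j) := by simp [trl]
    have h2 : pderiv i (X j + C (w j)) = trl w (pderiv i (X j)) := by
      simp only [map_add, pderiv_C, add_zero, pderiv_X]
      by_cases h : i = j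
      · subst h; simp
      · simp [Ne.symm h]
    rw [map_mul, h1, pderiv_mul, h2, pderiv_mul, map_add (trl w), map_mul, map_mul, h1, hp]

theorem mderiv_trl (w : Fin n → ℂ) (a : Fin n → ℕ) (F : MvPolynomial (Fin n) ℂ) :
    mderiv a (trl w F) = trl w (mderiv a F) := by
  unfold mderiv
  induction List.finRange n with
  | nil => rfl
  | cons i l ih =>
    simp only [List.foldr_cons, ih]
    induction a i with
    | zero => rfl
    | succ k ihk => rw [Function.iterate_succ_apply', ihk, pderiv_trl, Function.iterate_succ_apply']

theorem coeff_iter_pderiv (i : Fin n) (k : ℕ) (m : Fin n →₀ ℕ) :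
    ∃ c : ℂ, c ≠ 0 ∧ ∀ F : MvPolynomial (Fin n) ℂ,
      coeff m ((fun p => pderiv i p)^[k] F) = c * coeff (m + Finsupp.single i k) F := by
  induction k generalizing m with
  | zero => exact ⟨1, one_ne_zero, fun F => by simp⟩
  | succ k ih =>
    obtain ⟨c, hc, h⟩ := ih (m + Finsupp.single i 1)
    refine ⟨c * ((m i : ℂ) + 1), mul_ne_zero hc (Nat.cast_add_one_ne_zero _), ?_⟩
    intro F
    rw [Function.iterate_succ_apply', coeff_pderiv, h, add_assoc, ← Finsupp.single_add,
      add_comm 1 k]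
    ring

theorem coeff_foldr (a : Fin n → ℕ) (l : List (Fin n)) (m : Fin n →₀ ℕ) :
    ∃ c : ℂ, c ≠ 0 ∧ ∀ F : MvPolynomial (Fin n) ℂ,
      coeff m (l.foldr (fun i acc => (fun p => pderiv i p)^[a i] acc) F)
        = c * coeff (m + (l.map fun i => Finsupp.single i (a i)).sum) F := by
  induction l generalizing m with
  | nil => exact ⟨1, one_ne_zero, fun F => by simp⟩
  | cons i l ih =>
    obtain ⟨c1, hc1, h1⟩ := coeff_iter_pderiv i (a i) m
    obtain ⟨c2, hc2, h2⟩ := ih (m + Finsupp.single i (a i))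
    refine ⟨c1 * c2, mul_ne_zero hc1 hc2, fun F => ?_⟩
    rw [List.foldr_cons, h1, h2, List.map_cons, List.sum_cons, add_assoc, mul_assoc]

theorem eval_mderiv (a : Fin n →₀ ℕ) (w : Fin n → ℂ) :
    ∃ c : ℂ, c ≠ 0 ∧ ∀ F : MvPolynomial (Fin n) ℂ,
      eval w (mderiv a F) = c * coeff a (trl w F) := by
  obtain ⟨c, hc, h⟩ := coeff_foldr a (List.finRange n) 0
  refine ⟨c, hc, fun F => ?_⟩
  have h1 : ((List.finRange n).map fun i => Finsupp.single i (a i)).sum = a := by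
    rw [← Fin.sum_univ_def]
    exact Finsupp.univ_sum_single a
  have h2 : eval w (mderiv a F) = coeff 0 (mderiv a (trl w F)) := by
    rw [mderiv_trl, ← constantCoeff_eq, ← eval_zero, eval_trl, zero_add]
  rw [h2, mderiv, h, h1, zero_add]

theorem coeff_single_trl (w : Fin n → ℂ) (i : Fin n) (F : MvPolynomial (Fin n) ℂ) :
    coeff (Finsupp.single i 1) (trl w F) = eval w (pderiv i F) := by
  have h2 : eval w (pderiv i F) = coeff 0 (pderiv i (trl w F)) := by
    rw [pderiv_trl, ← constantCoeff_eq, ← eval_zero, eval_trl, zero_add]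
  rw [h2, coeff_pderiv]
  simp

theorem coeff_scale (s : Fin n → ℂ) (a : Fin n →₀ ℕ) (F : MvPolynomial (Fin n) ℂ) :
    coeff a (aeval (fun i => C (s i) * X i) F : MvPolynomial (Fin n) ℂ)
      = (∏ i, s i ^ a i) * coeff a F := by
  classical
  induction F using MvPolynomial.induction_on' with
  | monomial m c =>
    have : (aeval (fun i => C (s i) * X i) (monomial m c) : MvPolynomial (Fin n) ℂ)
        = monomial m ((∏ i, s i ^ m i) * c) := by
      rw [aeval_monomial, Finsupp.prod_fintype _ _ (by simp)]
      simp only [mul_pow, Finset.prod_mul_distrib]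
      rw [monomial_eq, Finsupp.prod_fintype _ _ (by simp), algebraMap_eq, C_mul, map_prod]
      simp only [map_pow]
      ring
    rw [this, coeff_monomial, coeff_monomial]
    split_ifs with h
    · rw [h]
    · simp
  | add p q hp hq => rw [map_add, coeff_add, coeff_add, hp, hq, mul_add]

/-! ### Leading terms with respect to a weight -/

/-- `L` is the lowest weight part, of weight `m`, of `F`. -/
def LeadT (d : Fin n → ℕ) (m : ℕ) (F L : MvPolynomial (Fin n) ℂ) : Prop :=
  IsWeightedHomogeneous d L m ∧ ∀ a, coeff a (F - L) ≠ 0 → m < Finsupp.weight d a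

theorem LeadT.mul {d : Fin n → ℕ} {m k : ℕ} {F L Fb Lb : MvPolynomial (Fin n) ℂ}
    (h : LeadT d m F L) (hprm : LeadT d k Fb Lb) : LeadT d (m + k) (F * Fb) (L * Lb) := by
  classical
  refine ⟨h.1.mul hprm.1, fun a ha => ?_⟩
  have key : ∀ A B : MvPolynomial (Fin n) ℂ, coeff a (A * B) ≠ 0 →
      ∃ b c, coeff b A ≠ 0 ∧ coeff c B ≠ 0 ∧ b + c = a := by
    intro A B hab
    rw [coeff_mul] at hab
    obtain ⟨p, hp, hne⟩ := Finset.exists_ne_zero_of_sum_ne_zero hab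
    exact ⟨p.1, p.2, left_ne_zero_of_mul hne, right_ne_zero_of_mul hne,
      Finset.HasAntidiagonal.mem_antidiagonal.1 hp⟩
  have e : F * Fb - L * Lb = (F - L) * Lb + (L * (Fb - Lb) + (F - L) * (Fb - Lb)) := by ring
  rw [e, coeff_add, coeff_add] at ha
  by_cases h1 : coeff a ((F - L) * Lb) = 0
  · by_cases h2 : coeff a (L * (Fb - Lb)) = 0
    · rw [h1, h2, zero_add, zero_add] at ha
      obtain ⟨b, c, hb, hc, rfl⟩ := key _ _ ha
      have := h.2 b hb
      have := hprm.2 c hc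
      rw [map_add]; omega
    · obtain ⟨b, c, hb, hc, rfl⟩ := key _ _ h2
      have := h.1 hb
      have := hprm.2 c hc
      rw [map_add]; omega
  · obtain ⟨b, c, hb, hc, rfl⟩ := key _ _ h1
    have := h.2 b hb
    have := hprm.1 hc
    rw [map_add]; omega

theorem LeadT.one (d : Fin n → ℕ) : LeadT d 0 1 1 :=
  ⟨isWeightedHomogeneous_one _ _, fun a h => by simp at h⟩

theorem LeadT.pow {d : Fin n → ℕ} {m : ℕ} {F L : MvPolynomial (Fin n) ℂ}
    (h : LeadT d m F L) (k : ℕ) : LeadT d (k * m) (F ^ k) (L ^ k) := by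
  induction k with
  | zero => simpa using LeadT.one d
  | succ k ih =>
    rw [pow_succ, pow_succ, Nat.succ_mul]
    exact ih.mul h

theorem LeadT.prod {d : Fin n → ℕ} (s : Finset (Fin n)) {m : Fin n → ℕ}
    {F L : Fin n → MvPolynomial (Fin n) ℂ}
    (h : ∀ i ∈ s, LeadT d (m i) (F i) (L i)) :
    LeadT d (∑ i ∈ s, m i) (∏ i ∈ s, F i) (∏ i ∈ s, L i) := by
  classical
  induction s using Finset.induction_on with
  | empty => simpa using LeadT.one d
  | insert i s hi ih =>
    rw [Finset.sum_insert hi, Finset.prod_insert hi, Finset.prod_insert hi]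
    exact (h i (by simp)).mul (ih fun j hj => h j (by simp [hj]))

theorem LeadT.component {d : Fin n → ℕ} {m : ℕ} {F L : MvPolynomial (Fin n) ℂ}
    (h : LeadT d m F L) : weightedHomogeneousComponent d m F = L := by
  classical
  ext a
  rw [coeff_weightedHomogeneousComponent]
  split_ifs with ha
  · by_contra hne
    have := h.2 a (by rw [coeff_sub]; exact sub_ne_zero.2 hne)
    omega
  · exact (h.1.coeff_eq_zero a ha).symm

theorem weight_eq_sum (d : Fin n → ℕ) (a : Fin n →₀ ℕ) :
    Finsupp.weight d a = ∑ i, a i * d i := by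
  rw [Finsupp.weight_apply, Finsupp.sum_fintype _ _ (by simp)]
  simp

theorem aeval_homog (d : Fin n → ℕ) (x : Fin n → MvPolynomial (Fin n) ℂ)
    (hx : ∀ i, (x i).IsHomogeneous (d i)) (p : MvPolynomial (Fin n) ℂ) (m : ℕ) :
    homogeneousComponent m (aeval x p) = aeval x (weightedHomogeneousComponent d m p) := by
  classical
  induction p using MvPolynomial.induction_on' with
  | monomial a c =>
    have h1 : (aeval x (monomial a c)).IsHomogeneous (Finsupp.weight d a) := by
      rw [aeval_monomial, Finsupp.prod_fintype _ _ (by simp), weight_eq_sum, algebraMap_eq]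
      refine IsHomogeneous.C_mul (IsHomogeneous.prod _ _ _ fun i _ => ?_) c
      rw [mul_comm]
      exact (hx i).pow _
    rw [homogeneousComponent_of_mem h1, weightedHomogeneousComponent_of_mem
      (isWeightedHomogeneous_monomial d a c rfl)]
    split_ifs <;> simp
  | add p q hp hq => rw [map_add, map_add, map_add, map_add, hp, hq]

/-! ### Main argument -/

theorem degree_one_single {a : Fin n →₀ ℕ} (h : a.degree = 1) : ∃ β, a = Finsupp.single β 1 := by
  classical
  have h0 : a ≠ 0 := by
    rintro rfl
    simp at h
  obtain ⟨β, hβ⟩ := Finsupp.ne_iff.1 h0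
  have hβ : a β ≠ 0 := hβ
  rw [Finsupp.degree_eq_sum, ← Finset.add_sum_erase _ _ (Finset.mem_univ β)] at h
  have h1 : a β = 1 := by omega
  have h2 : ∑ j ∈ Finset.univ.erase β, a j = 0 := by omega
  rw [Finset.sum_eq_zero_iff] at h2
  refine ⟨β, Finsupp.ext fun j => ?_⟩
  by_cases hj : j = β
  · rw [hj, h1, Finsupp.single_eq_same]
  · rw [h2 j (by simp [hj]), Finsupp.single_eq_of_ne hj]

/-- The polynomial `F` in the coordinates `z` centered at `q`. -/
def Phi (P : GL (Fin n) ℂ) (q : Fin n → ℂ) : MvPolynomial (Fin n) ℂ →ₐ[ℂ] MvPolynomial (Fin n) ℂ :=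
  (trl (P.val *ᵥ q)).comp (pback (P⁻¹).val)

/-- The Jacobian at `q` in the coordinates `z`. -/
def Jq (P : GL (Fin n) ℂ) (q : Fin n → ℂ) (x : Fin n → MvPolynomial (Fin n) ℂ) :
    Matrix (Fin n) (Fin n) ℂ :=
  Matrix.of fun α β => coeff (Finsupp.single β 1) (Phi P q (x α))

theorem inv_mulVec_mulVec (P : GL (Fin n) ℂ) (v : Fin n → ℂ) :
    (P⁻¹).val *ᵥ (P.val *ᵥ v) = v := by
  rw [Matrix.mulVec_mulVec, ← Units.val_mul, inv_mul_cancel, Units.val_one, Matrix.one_mulVec]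

theorem mulVec_inv_mulVec (P : GL (Fin n) ℂ) (v : Fin n → ℂ) :
    P.val *ᵥ ((P⁻¹).val *ᵥ v) = v := by
  rw [Matrix.mulVec_mulVec, ← Units.val_mul, mul_inv_cancel, Units.val_one, Matrix.one_mulVec]

theorem eval_Phi (P : GL (Fin n) ℂ) (q v : Fin n → ℂ) (F : MvPolynomial (Fin n) ℂ) :
    eval v (Phi P q F) = eval ((P⁻¹).val *ᵥ v + q) F := by
  simp only [Phi, AlgHom.comp_apply, eval_trl, eval_pback, Matrix.mulVec_add, inv_mulVec_mulVec]

theorem homog_eval_smul {F : MvPolynomial (Fin n) ℂ} {m : ℕ} (hF : F.IsHomogeneous m)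
    (c : ℂ) (v : Fin n → ℂ) : eval (c • v) F = c ^ m * eval v F := by
  rw [eval_eq', eval_eq', Finset.mul_sum]
  refine Finset.sum_congr rfl fun a ha => ?_
  have h1 : ∑ i, a i = m := by
    have := hF (mem_support_iff.1 ha)
    rw [Finsupp.weight_apply, Finsupp.sum_fintype _ _ (by simp)] at this
    simpa using this
  simp only [Pi.smul_apply, smul_eq_mul, mul_pow, Finset.prod_mul_distrib]
  rw [Finset.prod_pow_eq_pow_sum, h1]
  ring

theorem eval_coordPoly (P : GL (Fin n) ℂ) (α : Fin n) (v : Fin n → ℂ) :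
    eval v (coordPoly P α) = (P.val *ᵥ v) α := by
  simp [coordPoly, Matrix.mulVec, dotProduct]

theorem coeff_cong [NeZero n] (G : Subgroup (GL (Fin n) ℂ))
    (d : Fin n → ℕ) (g : GL (Fin n) ℂ) (ζ : ℂ) (q : Fin n → ℂ) (hT : AdmissibleTriplet G d g ζ q)
    (P : GL (Fin n) ℂ) (hP : GradedCoords g ζ d P)
    (x : Fin n → MvPolynomial (Fin n) ℂ) (hx : BasicInvariants G d x) (α : Fin n)
    (a : Fin n →₀ ℕ) (ha : coeff a (Phi P q (x α)) ≠ 0) :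
    ζ ^ (Finsupp.weight d a) = ζ ^ d α := by
  have hζ : ζ ≠ 0 := hT.prim.ne_zero (hx.pos 0).ne'
  have hgP : ∀ u : Fin n → ℂ, ∀ β,
      (P.val *ᵥ ((g⁻¹).val *ᵥ u)) β = ζ ^ (d β - 1) * (P.val *ᵥ u) β := by
    intro u β
    have := congrArg (eval u) (hP β)
    rw [eval_pback, eval_coordPoly, map_mul, eval_C, eval_coordPoly] at this
    rw [this]
    congr 1
    have h1 := hx.pos β
    rw [show ((d β : ℤ) - 1) = ((d β - 1 : ℕ) : ℤ) by omega, zpow_natCast]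
  have hgq : (g⁻¹).val *ᵥ (ζ • q) = q := by
    rw [← hT.eig, inv_mulVec_mulVec]
  have hid : (aeval (fun i => C (ζ ^ d i) * X i) (Phi P q (x α)) : MvPolynomial (Fin n) ℂ)
      = C (ζ ^ d α) * Phi P q (x α) := by
    apply MvPolynomial.funext
    intro v
    have e1 : eval v (aeval (fun i => C (ζ ^ d i) * X i) (Phi P q (x α)) : MvPolynomial (Fin n) ℂ)
        = eval (fun i => ζ ^ d i * v i) (Phi P q (x α)) := by
      induction Phi P q (x α) using MvPolynomial.induction_on with
      | C a => simp
      | add p q hp hq => rw [map_add, map_add, map_add, hp, hq]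
      | mul_X p i hp =>
        rw [map_mul, map_mul, map_mul, hp]
        congr 1
        simp
    rw [e1, map_mul, eval_C, eval_Phi, eval_Phi, ← homog_eval_smul (hx.homog α)]
    conv_rhs => rw [← hx.invariant g⁻¹ (G.inv_mem hT.reg.1) α, eval_pback]
    congr 2
    rw [smul_add, Matrix.mulVec_add, hgq]
    congr 1
    rw [← inv_mulVec_mulVec P ((g⁻¹).val *ᵥ ζ • (P⁻¹).val *ᵥ v)]
    congr 1
    funext β
    rw [hgP, Matrix.mulVec_smul, mulVec_inv_mulVec, Pi.smul_apply, smul_eq_mul, ← mul_assoc,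
      ← pow_succ, Nat.sub_add_cancel (hx.pos β)]
  have hc := congrArg (coeff a) hid
  rw [coeff_scale, coeff_C_mul] at hc
  have := mul_right_cancel₀ ha hc
  rw [← this, weight_eq_sum, ← Finset.prod_pow_eq_pow_sum]
  exact Finset.prod_congr rfl fun i _ => by rw [← pow_mul, mul_comm]

theorem lin_coeff (c : Fin n → ℂ) (β : Fin n) :
    coeff (Finsupp.single β 1) (∑ j, C (c j) * X j : MvPolynomial (Fin n) ℂ) = c β := by
  classical
  rw [coeff_sum, Finset.sum_eq_single β]
  · simp
  · intro j _ hj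
    simp [coeff_C_mul, coeff_X, Finsupp.single_left_inj, hj]
  · simp

theorem pback_X (M : Matrix (Fin n) (Fin n) ℂ) (α : Fin n) :
    pback M (X α) = ∑ j, C (M α j) * X j := by simp [pback]

theorem homog_pback (M : Matrix (Fin n) (Fin n) ℂ) {F : MvPolynomial (Fin n) ℂ} {m : ℕ}
    (hF : F.IsHomogeneous m) : (pback M F).IsHomogeneous m := by
  have := hF.aeval (fun i => ∑ j, C (M i j) * X j) (n := 1)
    (fun i => IsHomogeneous.sum _ _ _ fun j _ => isHomogeneous_C_mul_X _ _)
  rw [one_mul] at this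
  exact this

theorem comp_lin [NeZero n] (G : Subgroup (GL (Fin n) ℂ))
    (d : Fin n → ℕ) (hd : Antitone d)
    (g : GL (Fin n) ℂ) (ζ : ℂ) (q : Fin n → ℂ) (hT : AdmissibleTriplet G d g ζ q)
    (P : GL (Fin n) ℂ) (hP : GradedCoords g ζ d P)
    (x : Fin n → MvPolynomial (Fin n) ℂ) (hx : BasicInvariants G d x)
    (hgx : IsGood P q d x) (α : Fin n) :
    weightedHomogeneousComponent d (d α) (Phi P q (x α)) = pback (Jq P q x) (X α) := by
  classical
  have hM : ∀ β, Jq P q x α β ≠ 0 → d β = d α := by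
    intro β h
    have h1 := coeff_cong G d g ζ q hT P hP x hx α _ h
    rw [weight_eq_sum] at h1
    have h2 : ∑ i, (Finsupp.single β 1 : Fin n →₀ ℕ) i * d i = d β := by
      rw [Finset.sum_eq_single β]
      · simp
      · intro j _ hj
        simp [Ne.symm hj]
      · simp
    rw [h2] at h1
    have b1 := hd (Fin.zero_le β)
    have b2 := hd (Fin.zero_le α)
    have p1 := hx.pos β
    have p2 := hx.pos α
    have hζ : ζ ≠ 0 := hT.prim.ne_zero (hx.pos 0).ne'
    have h3 : ζ ^ (d β - 1) = ζ ^ (d α - 1) := by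
      apply mul_right_cancel₀ hζ
      rw [← pow_succ, ← pow_succ, Nat.sub_add_cancel p1, Nat.sub_add_cancel p2, h1]
    have := hT.prim.pow_inj (by omega) (by omega) h3
    omega
  have hw : IsWeightedHomogeneous d (pback (Jq P q x) (X α)) (d α) := by
    rw [pback_X]
    refine IsWeightedHomogeneous.sum _ _ _ fun β _ => ?_
    by_cases h : Jq P q x α β = 0
    · rw [h, C_0, zero_mul]
      exact isWeightedHomogeneous_zero _ _ _
    · rw [← hM β h]
      exact (isWeightedHomogeneous_X _ _ _).C_mul _
  ext a
  rw [coeff_weightedHomogeneousComponent]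
  split_ifs with ha
  · by_cases h2 : 2 ≤ a.degree
    · have hz : coeff a (pback (Jq P q x) (X α)) = 0 :=
        (homog_pback _ (isHomogeneous_X ℂ α)).coeff_eq_zero (by omega)
      rw [hz]
      obtain ⟨c, hc, h⟩ := eval_mderiv a (P.val *ᵥ q)
      have h3 := hgx α a (by rw [← weight_eq_sum]; exact ha)
        (by rw [← Finsupp.degree_eq_sum]; exact h2)
      rw [zderivAt, h] at h3
      exact (mul_eq_zero.1 h3).resolve_left hc
    · have h1 : a.degree ≠ 0 := by
        intro h0
        rw [Finsupp.degree_eq_zero_iff] at h0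
        rw [h0, map_zero] at ha
        exact (hx.pos α).ne ha
      have h1 : a.degree = 1 := by omega
      obtain ⟨β, rfl⟩ := degree_one_single h1
      rw [pback_X, lin_coeff]
      rfl
  · exact (hw.coeff_eq_zero a ha).symm

theorem lead_lin [NeZero n] (G : Subgroup (GL (Fin n) ℂ))
    (d : Fin n → ℕ) (hd : Antitone d)
    (g : GL (Fin n) ℂ) (ζ : ℂ) (q : Fin n → ℂ) (hT : AdmissibleTriplet G d g ζ q)
    (P : GL (Fin n) ℂ) (hP : GradedCoords g ζ d P)
    (x : Fin n → MvPolynomial (Fin n) ℂ) (hx : BasicInvariants G d x)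
    (hgx : IsGood P q d x) (α : Fin n) (hα : d α < d 0) :
    LeadT d (d α) (Phi P q (x α)) (pback (Jq P q x) (X α)) := by
  classical
  have hc := comp_lin G d hd g ζ q hT P hP x hx hgx α
  refine ⟨by rw [← hc]; exact weightedHomogeneousComponent_isWeightedHomogeneous _ _,
    fun a ha => ?_⟩
  rw [← hc, coeff_sub, coeff_weightedHomogeneousComponent] at ha
  split_ifs at ha with h
  · simp at ha
  · rw [sub_zero] at ha
    by_contra hlt
    push Not at hlt
    exact h (hT.prim.pow_inj (by omega) hα (coeff_cong G d g ζ q hT P hP x hx α _ ha))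

theorem comp_aeval [NeZero n] (G : Subgroup (GL (Fin n) ℂ))
    (d : Fin n → ℕ) (hd : Antitone d)
    (g : GL (Fin n) ℂ) (ζ : ℂ) (q : Fin n → ℂ) (hT : AdmissibleTriplet G d g ζ q)
    (P : GL (Fin n) ℂ) (hP : GradedCoords g ζ d P)
    (x : Fin n → MvPolynomial (Fin n) ℂ) (hx : BasicInvariants G d x)
    (hgx : IsGood P q d x) (α : Fin n) (p : MvPolynomial (Fin n) ℂ)
    (hp : IsWeightedHomogeneous d p (d α)) :
    weightedHomogeneousComponent d (d α) (Phi P q (aeval x p)) = pback (Jq P q x) p := by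
  classical
  conv_lhs => rw [← support_sum_monomial_coeff p]
  conv_rhs => rw [← support_sum_monomial_coeff p]
  simp only [map_sum]
  refine Finset.sum_congr rfl fun a ha => ?_
  have hwa : Finsupp.weight d a = d α := hp (mem_support_iff.1 ha)
  have hα0 := hd (Fin.zero_le α)
  have e1 : ∀ c, Phi P q (aeval x (monomial a c)) = C c * ∏ i, (Phi P q (x i)) ^ a i := by
    intro c
    rw [aeval_monomial, Finsupp.prod_fintype _ _ (by simp), map_mul, map_prod]
    simp only [map_pow]
    congr 1
    exact AlgHom.commutes _ _
  have e2 : ∀ c, pback (Jq P q x) (monomial a c)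
      = C c * ∏ i, (pback (Jq P q x) (X i)) ^ a i := by
    intro c
    rw [monomial_eq, Finsupp.prod_fintype _ _ (by simp), map_mul, map_prod]
    simp only [map_pow]
    congr 1
    exact AlgHom.commutes _ _
  rw [e1, e2, weightedHomogeneousComponent_C_mul]
  congr 1
  by_cases h : ∀ i, a i ≠ 0 → d i < d 0
  · apply LeadT.component
    rw [← hwa, weight_eq_sum]
    apply LeadT.prod
    intro i _
    by_cases hi : a i = 0
    · rw [hi, zero_mul, pow_zero, pow_zero]
      exact LeadT.one d
    · exact (lead_lin G d hd g ζ q hT P hP x hx hgx i (h i hi)).pow _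
  · push Not at h
    obtain ⟨i, hi, hdi⟩ := h
    have hsum := weight_eq_sum d a
    rw [← Finset.add_sum_erase _ _ (Finset.mem_univ i)] at hsum
    have hpos := hx.pos 0
    have hai : a i = 1 := by
      by_contra hne
      have : 2 ≤ a i := by omega
      have : 2 * d i ≤ a i * d i := Nat.mul_le_mul_right _ this
      omega
    rw [hai, one_mul] at hsum
    have h0 : ∑ j ∈ Finset.univ.erase i, a j * d j = 0 := by omega
    have hdα : d i = d α := by omega
    rw [Finset.sum_eq_zero_iff] at h0
    have haj : ∀ j, j ≠ i → a j = 0 := fun j hj =>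
      (mul_eq_zero.1 (h0 j (by simp [hj]))).resolve_right (hx.pos j).ne'
    rw [Finset.prod_eq_single i (fun j _ hj => by rw [haj j hj, pow_zero]) (by simp),
      Finset.prod_eq_single i (fun j _ hj => by rw [haj j hj, pow_zero]) (by simp),
      hai, pow_one, pow_one, ← hdα]
    exact comp_lin G d hd g ζ q hT P hP x hx hgx i

theorem det_Jq (G : Subgroup (GL (Fin n) ℂ)) [Finite G]
    (d : Fin n → ℕ) (x : Fin n → MvPolynomial (Fin n) ℂ) (hx : BasicInvariants G d x)
    (q : Fin n → ℂ) (hq : IsRegularVec G q) (P : GL (Fin n) ℂ) :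
    (Jq P q x).det ≠ 0 := by
  have h : Jq P q x = (Matrix.of fun i j => eval q (pderiv j (x i))) * (P⁻¹).val := by
    ext α β
    have h1 : ∀ F : MvPolynomial (Fin n) ℂ, pderiv β F = dirD (Pi.single β 1) F := by
      intro F
      rw [dirD_eq_sum, Finset.sum_eq_single β]
      · simp
      · intro j _ hj
        simp [hj]
      · simp
    rw [Jq, Matrix.of_apply, Phi, AlgHom.comp_apply, coeff_single_trl, h1, eval_dirD_pback,
      inv_mulVec_mulVec, dirD_eq_sum, Matrix.mul_apply, map_sum, Matrix.mulVec_single_one]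
    refine Finset.sum_congr rfl fun j _ => ?_
    rw [map_mul, eval_C, mul_comm]
    rfl
  rw [h, Matrix.det_mul]
  refine mul_ne_zero (jac_of_regular G d x hx q hq) ?_
  exact ((Matrix.isUnit_iff_isUnit_det _).1 (P⁻¹).isUnit).ne_zero

theorem lin_eq {p : MvPolynomial (Fin n) ℂ} (hp : p.IsHomogeneous 1) :
    p = ∑ β, C (coeff (Finsupp.single β 1) p) * X β := by
  ext a
  by_cases h : a.degree = 1
  · obtain ⟨β, rfl⟩ := degree_one_single h
    rw [lin_coeff]
  · rw [hp.coeff_eq_zero h, IsHomogeneous.coeff_eq_zero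
      (IsHomogeneous.sum _ _ _ fun j _ => isHomogeneous_C_mul_X _ _) h]

theorem good_main [NeZero n] (G : Subgroup (GL (Fin n) ℂ)) [Finite G]
    (d : Fin n → ℕ) (hd : Antitone d)
    (g : GL (Fin n) ℂ) (ζ : ℂ) (q : Fin n → ℂ) (hT : AdmissibleTriplet G d g ζ q)
    (P : GL (Fin n) ℂ) (hP : GradedCoords g ζ d P)
    (x y : Fin n → MvPolynomial (Fin n) ℂ)
    (hx : BasicInvariants G d x) (hy : BasicInvariants G d y)
    (hgx : IsGood P q d x) (hgy : IsGood P q d y) (α : Fin n) :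
    ∃ A : Fin n → ℂ, (∀ β, d β ≠ d α → A β = 0) ∧ y α = ∑ β, C (A β) * x β := by
  classical
  have hmem := hx.gen (y α) (fun g hg => hy.invariant g hg α)
  rw [Algebra.adjoin_range_eq_range_aeval] at hmem
  obtain ⟨p0, hp0⟩ := hmem
  obtain ⟨p, hp, hpy⟩ : ∃ p, IsWeightedHomogeneous d p (d α) ∧ aeval x p = y α := by
    refine ⟨weightedHomogeneousComponent d (d α) p0,
      weightedHomogeneousComponent_isWeightedHomogeneous _ _, ?_⟩
    rw [← aeval_homog d x hx.homog]
    have : aeval x p0 = y α := hp0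
    rw [this]
    exact homogeneousComponent_eq_self (hy.homog α)
  have h1 := comp_aeval G d hd g ζ q hT P hP x hx hgx α p hp
  rw [hpy, comp_lin G d hd g ζ q hT P hP y hy hgy α] at h1
  have hdet := det_Jq G d x hx q hT.regq P
  have h2 : (pback (Jq P q x) p).IsHomogeneous 1 := by
    rw [← h1]; exact homog_pback _ (isHomogeneous_X ℂ α)
  have h3 : p.IsHomogeneous 1 := by
    have := homog_pback (Jq P q x)⁻¹ h2
    rwa [pback_mul, Matrix.mul_nonsing_inv _ (isUnit_iff_ne_zero.2 hdet), pback_one] at this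
  refine ⟨fun β => coeff (Finsupp.single β 1) p, fun β hβ => ?_, ?_⟩
  · apply hp.coeff_eq_zero
    rw [Finsupp.weight_single]
    simpa using hβ
  · rw [← hpy]
    conv_lhs => rw [lin_eq h3]
    rw [map_sum]
    refine Finset.sum_congr rfl fun β _ => ?_
    rw [map_mul, aeval_X]
    congr 1
    exact AlgHom.commutes _ _

theorem stmt_9 [NeZero n] (G : Subgroup (GL (Fin n) ℂ)) (hG : IsReflectionGroup G)
    (d : Fin n → ℕ) (hd : Antitone d)
    (g : GL (Fin n) ℂ) (ζ : ℂ) (q : Fin n → ℂ) (hT : AdmissibleTriplet G d g ζ q)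
    (P : GL (Fin n) ℂ) (hP : GradedCoords g ζ d P)
    (x y : Fin n → MvPolynomial (Fin n) ℂ)
    (hx : BasicInvariants G d x) (hy : BasicInvariants G d y)
    (hgx : IsGood P q d x) (hgy : IsGood P q d y) :
    ∃ A : Fin n → Fin n → ℂ,
      (∀ α β, d β ≠ d α → A α β = 0) ∧
      (∀ α, y α = ∑ β, C (A α β) * x β) ∧
      Submodule.span ℂ (Set.range y) = Submodule.span ℂ (Set.range x) := by
  have : Finite G := hG.1
  have H1 := good_main G d hd g ζ q hT P hP x y hx hy hgx hgy
  have H2 := good_main G d hd g ζ q hT P hP y x hy hx hgy hgx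
  have span_le : ∀ u w : Fin n → MvPolynomial (Fin n) ℂ,
      (∀ α, ∃ A : Fin n → ℂ, (∀ β, d β ≠ d α → A β = 0) ∧ u α = ∑ β, C (A β) * w β) →
      Submodule.span ℂ (Set.range u) ≤ Submodule.span ℂ (Set.range w) := by
    intro u w h
    rw [Submodule.span_le]
    rintro _ ⟨α, rfl⟩
    obtain ⟨A, -, hA⟩ := h α
    rw [hA]
    refine Submodule.sum_mem _ fun β _ => ?_
    rw [← smul_eq_C_mul]
    exact Submodule.smul_mem _ _ (Submodule.subset_span ⟨β, rfl⟩)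
  choose A hA using H1
  exact ⟨A, fun α => (hA α).1, fun α => (hA α).2,
    le_antisymm (span_le y x fun α => ⟨A α, hA α⟩) (span_le x y H2)⟩

end
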